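/- arXiv:2203.14583 — 3 statements merged into one kernel-verified Lean document; each statement's English description precedes it below -/
import Mathlib

section
/- Let N ≥ 1, let C ⊆ ℝ^N be a convex set, and let g : C → ℝ be a convex function which is bounded above. Then for every x ∈ C and every y ∈ rec(C): (a) g(x + λy) ≤ g(x) for all real λ ≥ 0; and (b) the difference quotients (g(x + λy) − g(x))/λ converge, as λ → +∞, to a real number r with r ≤ 0. -/
open Filter

/-- A convex set contains every half-line in a direction by which it can be translated. -/
theorem Convex.add_smul_mem_of_forall_add_mem {E : Type*} [AddCommGroup E] [Module ℝ E]
    {C : Set E} (hC : Convex ℝ C) {y : E} (hy : ∀ x ∈ C, x + y ∈ C) {x : E} (hx : x ∈ C)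
    {l : ℝ} (hl : 0 ≤ l) : x + l • y ∈ C := by
  have hnat : ∀ n : ℕ, x + (n : ℝ) • y ∈ C := by
    intro n
    induction n with
    | zero => simpa using hx
    | succ n ih =>
      rw [Nat.cast_succ, add_smul, one_smul, ← add_assoc]
      exact hy _ ih
  obtain ⟨n, hn⟩ := exists_nat_gt l
  have hn0 : (0 : ℝ) < n := hl.trans_lt hn
  have h := hC.add_smul_mem hx (hnat n) ⟨div_nonneg hl hn0.le, (div_le_one hn0).2 hn.le⟩
  rwa [smul_smul, div_mul_cancel₀ _ hn0.ne'] at h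

/-- The slopes from the origin of a convex function on `[0, ∞)` are monotone. -/
theorem ConvexOn.div_le_div_of_Ici {φ : ℝ → ℝ} (hφ : ConvexOn ℝ (Set.Ici 0) φ)
    {s t : ℝ} (hs : 0 < s) (hst : s ≤ t) : (φ s - φ 0) / s ≤ (φ t - φ 0) / t := by
  have ht : 0 < t := hs.trans_le hst
  simpa using hφ.secant_mono (Set.mem_Ici.2 le_rfl) (Set.mem_Ici.2 hs.le)
    (Set.mem_Ici.2 ht.le) hs.ne' ht.ne' hst

/-- A convex function on `[0, ∞)` which is bounded above is maximal at the origin. -/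
theorem ConvexOn.le_apply_zero_of_bddAbove {φ : ℝ → ℝ} (hφ : ConvexOn ℝ (Set.Ici 0) φ)
    {B : ℝ} (hB : ∀ t, 0 ≤ t → φ t ≤ B) {l : ℝ} (hl : 0 ≤ l) : φ l ≤ φ 0 := by
  by_contra! h
  have hl0 : 0 < l := hl.lt_of_ne (by rintro rfl; exact h.false)
  set c := (φ l - φ 0) / l
  have hc : 0 < c := div_pos (sub_pos.2 h) hl0
  set t := max l ((B - φ 0) / c + 1)
  have ht : 0 < t := hl0.trans_le (le_max_left _ _)
  have h₁ : c * t ≤ φ t - φ 0 :=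
    (le_div_iff₀ ht).1 (hφ.div_le_div_of_Ici hl0 (le_max_left _ _))
  have h₂ : (B - φ 0) / c < t := (lt_add_one _).trans_le (le_max_right _ _)
  rw [div_lt_iff₀ hc] at h₂
  linarith [hB t ht.le]

/-- The slopes from the origin of a convex function on `[0, ∞)` which is bounded above converge
to a nonpositive real number. -/
theorem ConvexOn.exists_tendsto_div_atTop_of_bddAbove {φ : ℝ → ℝ}
    (hφ : ConvexOn ℝ (Set.Ici 0) φ) {B : ℝ} (hB : ∀ t, 0 ≤ t → φ t ≤ B) :
    ∃ r : ℝ, r ≤ 0 ∧ Tendsto (fun l : ℝ => (φ l - φ 0) / l) atTop (nhds r) := by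
  set F : ℝ → ℝ := fun l => (φ (max l 1) - φ 0) / max l 1
  have hpos : ∀ l : ℝ, 0 < max l 1 := fun l => zero_lt_one.trans_le (le_max_right _ _)
  have hmono : Monotone F := fun s t hst =>
    hφ.div_le_div_of_Ici (hpos s) (max_le_max_right 1 hst)
  have hF : ∀ l, F l ≤ 0 := fun l => div_nonpos_of_nonpos_of_nonneg
    (sub_nonpos.2 (hφ.le_apply_zero_of_bddAbove hB (hpos l).le)) (hpos l).le
  refine ⟨⨆ l, F l, ciSup_le hF, ?_⟩
  refine (tendsto_atTop_ciSup hmono ⟨0, Set.forall_mem_range.2 hF⟩).congr' ?_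
  filter_upwards [eventually_ge_atTop 1] with l hl
  simp only [F, max_eq_left hl]

/-- Let `C ⊆ ℝ^N` be a convex set and `g` a convex function on `C` which is bounded above.
Then for every `x ∈ C` and every `y` in the recession cone of `C`:
(a) `g (x + λ • y) ≤ g x` for all `λ ≥ 0`; and
(b) the difference quotients `(g (x + λ • y) - g x) / λ` converge as `λ → +∞` to a real
number `r ≤ 0`. -/
theorem recession_bounds (N : ℕ) (hN : 1 ≤ N)
    (C : Set (EuclideanSpace ℝ (Fin N))) (hC : Convex ℝ C)
    (g : EuclideanSpace ℝ (Fin N) → ℝ) (hg : ConvexOn ℝ C g)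
    (hbdd : ∃ B : ℝ, ∀ x ∈ C, g x ≤ B)
    (recC : Set (EuclideanSpace ℝ (Fin N)))
    (hrecC : recC = {y | ∀ x ∈ C, x + y ∈ C}) :
    ∀ x ∈ C, ∀ y ∈ recC,
      (∀ l : ℝ, 0 ≤ l → g (x + l • y) ≤ g x) ∧
      (∃ r : ℝ, r ≤ 0 ∧
        Tendsto (fun l : ℝ => (g (x + l • y) - g x) / l) atTop (nhds r)) := by
  subst hrecC
  obtain ⟨B, hB⟩ := hbdd
  intro x hx y hy
  have hmem : ∀ l : ℝ, 0 ≤ l → x + l • y ∈ C := fun l hl =>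
    hC.add_smul_mem_of_forall_add_mem hy hx hl
  have hφ : ConvexOn ℝ (Set.Ici 0) (fun l : ℝ => g (x + l • y)) := by
    refine ⟨convex_Ici 0, fun s hs t ht a b ha hb hab => ?_⟩
    have h := hg.2 (hmem s hs) (hmem t ht) ha hb hab
    have heq : a • (x + s • y) + b • (x + t • y) = x + (a • s + b • t) • y := by
      rw [smul_add, smul_add, add_add_add_comm, ← add_smul, hab, one_smul, add_smul,
        smul_assoc, smul_assoc]
    rwa [heq] at h
  have hbound : ∀ l : ℝ, 0 ≤ l → g (x + l • y) ≤ B := fun l hl => hB _ (hmem l hl)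
  exact ⟨fun l hl => by simpa using hφ.le_apply_zero_of_bddAbove hbound hl,
    by simpa using hφ.exists_tendsto_div_atTop_of_bddAbove hbound⟩
end

section
/- Let R be a commutative ring graded by ℕ × ℕ with homogeneous pieces J_{k,m}, and fix a rational number n > 0. If the subring J_{≤n} (the internal direct sum of the pieces J_{k,m} with m ≤ kn) is finitely generated as an algebra over J_{0,0}, then the subring J_n (the internal direct sum of the pieces J_{k,m} with m = kn) is finitely generated as an algebra over J_{0,0}. -/
namespace GradedRing

section Support

variable {ι R : Type*} [DecidableEq ι] [AddMonoid ι] [CommRing R]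
  (𝒜 : ι → AddSubgroup R) [GradedRing 𝒜]

/-- The additive subgroup of elements whose nonzero homogeneous components have degree in `S`. -/
def supportedIn (S : Set ι) : AddSubgroup R where
  carrier := {x | ∀ i, (DirectSum.decompose 𝒜 x i : R) ≠ 0 → i ∈ S}
  zero_mem' i h := by simp at h
  add_mem' {x y} hx hy i h := by
    by_contra hi
    have hx0 := not_not.1 (mt (hx i) hi)
    have hy0 := not_not.1 (mt (hy i) hi)
    simp [DirectSum.decompose_add, hx0, hy0] at h
  neg_mem' {x} hx i h := by
    refine hx i fun h0 => h ?_
    rw [DirectSum.decompose_neg]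
    exact (congrArg Subtype.val (DFinsupp.neg_apply _ i)).trans (by simp [h0])

variable {𝒜}

theorem supportedIn_of_mem {S : Set ι} {i : ι} {x : R} (hx : x ∈ 𝒜 i) (hi : i ∈ S) :
    x ∈ supportedIn 𝒜 S := by
  intro j hj
  by_contra h
  exact hj (DirectSum.decompose_of_mem_ne 𝒜 hx (fun hij => h (hij ▸ hi)))

theorem mul_mem_supportedIn {S T U : Set ι} (hSTU : ∀ i ∈ S, ∀ j ∈ T, i + j ∈ U) {x y : R}
    (hx : x ∈ supportedIn 𝒜 S) (hy : y ∈ supportedIn 𝒜 T) : x * y ∈ supportedIn 𝒜 U := by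
  classical
  intro k hk
  rw [DirectSum.decompose_mul, DirectSum.coe_mul_apply] at hk
  obtain ⟨⟨i, j⟩, hij, hne⟩ := Finset.exists_ne_zero_of_sum_ne_zero hk
  obtain rfl := (Finset.mem_filter.1 hij).2
  exact hSTU i (hx i (left_ne_zero_of_mul hne)) j (hy j (right_ne_zero_of_mul hne))

theorem eq_zero_of_mem_supportedIn_of_disjoint {S T : Set ι} (hST : Disjoint S T) {x : R}
    (hS : x ∈ supportedIn 𝒜 S) (hT : x ∈ supportedIn 𝒜 T) : x = 0 := by
  classical
  rw [← DirectSum.sum_support_decompose 𝒜 x]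
  refine Finset.sum_eq_zero fun i _ => ?_
  by_contra h
  exact Set.disjoint_left.1 hST (hS i h) (hT i h)

theorem exists_add_of_mem_supportedIn_union {S T : Set ι} {x : R}
    (hx : x ∈ supportedIn 𝒜 (S ∪ T)) :
    ∃ a ∈ supportedIn 𝒜 S, ∃ b ∈ supportedIn 𝒜 T, a + b = x := by
  classical
  refine ⟨_, AddSubgroup.sum_mem _ ?_, _, AddSubgroup.sum_mem _ ?_,
    (Finset.sum_filter_add_sum_filter_not _ (· ∈ S) _).trans
      (DirectSum.sum_support_decompose 𝒜 x)⟩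
  · intro i hi
    exact supportedIn_of_mem (SetLike.coe_mem _) (Finset.mem_filter.1 hi).2
  · intro i hi
    by_cases h : (DirectSum.decompose 𝒜 x i : R) = 0
    · rw [h]
      exact zero_mem _
    · exact supportedIn_of_mem (SetLike.coe_mem _)
        ((hx i h).resolve_left (Finset.mem_filter.1 hi).2)

/-- If `F` is a face of `F ∪ N`, then finite generation over the degree-zero part passes from
the elements supported in `F ∪ N` to those supported in `F`. -/
theorem exists_finset_supportedIn_face {F N : Set ι} (h0 : (0 : ι) ∈ F) (hdisj : Disjoint F N)
    (hFF : ∀ i ∈ F, ∀ j ∈ F, i + j ∈ F) (hFN : ∀ i ∈ F, ∀ j ∈ N, i + j ∈ N)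
    (hNF : ∀ i ∈ N, ∀ j ∈ F, i + j ∈ N) (hNN : ∀ i ∈ N, ∀ j ∈ N, i + j ∈ N)
    (hfg : ∃ s : Finset R, (s : Set R) ⊆ supportedIn 𝒜 (F ∪ N) ∧
      (supportedIn 𝒜 (F ∪ N) : Set R) ⊆ Subring.closure ((𝒜 0 : Set R) ∪ s)) :
    ∃ s : Finset R, (s : Set R) ⊆ supportedIn 𝒜 F ∧
      (supportedIn 𝒜 F : Set R) ⊆ Subring.closure ((𝒜 0 : Set R) ∪ s) := by
  classical
  obtain ⟨s, hs, hgen⟩ := hfg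
  choose! f hf g hg hfg using
    fun x (hx : x ∈ supportedIn 𝒜 (F ∪ N)) => exists_add_of_mem_supportedIn_union hx
  have hsF : ((s.image f : Finset R) : Set R) ⊆ supportedIn 𝒜 F := by
    intro y hy
    obtain ⟨x, hx, rfl⟩ := Finset.mem_image.1 hy
    exact hf x (hs hx)
  refine ⟨s.image f, hsF, fun x hx => ?_⟩
  set C := Subring.closure ((𝒜 0 : Set R) ∪ (s.image f : Finset R))
  have split : ∀ y ∈ Subring.closure ((𝒜 0 : Set R) ∪ s),
      ∃ a ∈ C, a ∈ supportedIn 𝒜 F ∧ ∃ b ∈ supportedIn 𝒜 N, a + b = y := by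
    intro y hy
    induction hy using Subring.closure_induction with
    | mem y hy =>
      rcases hy with hy | hy
      · exact ⟨y, Subring.subset_closure (.inl hy), supportedIn_of_mem hy h0, 0, zero_mem _,
          add_zero y⟩
      · exact ⟨f y, Subring.subset_closure (.inr (Finset.mem_image_of_mem f hy)), hf y (hs hy),
          g y, hg y (hs hy), hfg y (hs hy)⟩
    | zero => exact ⟨0, zero_mem _, zero_mem _, 0, zero_mem _, add_zero 0⟩
    | one =>
      exact ⟨1, one_mem _, supportedIn_of_mem SetLike.GradedOne.one_mem h0, 0, zero_mem _,
        add_zero 1⟩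
    | add y z _ _ hy hz =>
      obtain ⟨a, haC, ha, b, hb, rfl⟩ := hy
      obtain ⟨c, hcC, hc, d, hd, rfl⟩ := hz
      exact ⟨a + c, add_mem haC hcC, add_mem ha hc, b + d, add_mem hb hd, by ring⟩
    | neg y _ hy =>
      obtain ⟨a, haC, ha, b, hb, rfl⟩ := hy
      exact ⟨-a, neg_mem haC, neg_mem ha, -b, neg_mem hb, by ring⟩
    | mul y z _ _ hy hz =>
      obtain ⟨a, haC, ha, b, hb, rfl⟩ := hy
      obtain ⟨c, hcC, hc, d, hd, rfl⟩ := hz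
      exact ⟨a * c, mul_mem haC hcC, mul_mem_supportedIn hFF ha hc, a * d + (b * c + b * d),
        add_mem (mul_mem_supportedIn hFN ha hd)
          (add_mem (mul_mem_supportedIn hNF hb hc) (mul_mem_supportedIn hNN hb hd)), by ring⟩
  obtain ⟨a, haC, ha, b, hb, rfl⟩ :=
    split x (hgen fun i hi => Set.mem_union_left N (hx i hi))
  have hb0 : b = 0 := eq_zero_of_mem_supportedIn_of_disjoint hdisj
    (by simpa using sub_mem hx ha) hb
  simpa [hb0] using haC

end Support

end GradedRing

/-- Let `R` be a commutative ring graded by `ℕ × ℕ` with pieces `𝒜 (k, m)`, and let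
`n > 0` be a rational number.  Let `Jle` be the subring of elements all of whose
homogeneous components have bidegree `(k, m)` with `m ≤ k n`, and `Jn` the subring of
elements all of whose homogeneous components have bidegree `(k, m)` with `m = k n`.
If `Jle` is a finitely generated algebra over `𝒜 (0, 0)` then so is `Jn`. -/
theorem fixed_slope_finitely_generated {R : Type*} [CommRing R]
    (𝒜 : ℕ × ℕ → AddSubgroup R) [GradedRing 𝒜]
    (n : ℚ) (hn : 0 < n)
    (Jle : Set R)
    (hJle : Jle = {x : R | ∀ km : ℕ × ℕ,
      (DirectSum.decompose 𝒜 x km : R) ≠ 0 → (km.2 : ℚ) ≤ (km.1 : ℚ) * n})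
    (Jn : Set R)
    (hJn : Jn = {x : R | ∀ km : ℕ × ℕ,
      (DirectSum.decompose 𝒜 x km : R) ≠ 0 → (km.2 : ℚ) = (km.1 : ℚ) * n})
    (hfg : ∃ s : Finset R, (↑s : Set R) ⊆ Jle ∧
      Jle ⊆ ↑(Subring.closure ((𝒜 (0, 0) : Set R) ∪ ↑s))) :
    ∃ s : Finset R, (↑s : Set R) ⊆ Jn ∧
      Jn ⊆ ↑(Subring.closure ((𝒜 (0, 0) : Set R) ∪ ↑s)) := by
  subst hJle hJn
  have hle : {km : ℕ × ℕ | (km.2 : ℚ) = km.1 * n} ∪ {km : ℕ × ℕ | (km.2 : ℚ) < km.1 * n} =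
      {km : ℕ × ℕ | (km.2 : ℚ) ≤ km.1 * n} := by
    ext km
    exact le_iff_eq_or_lt.symm
  refine GradedRing.exists_finset_supportedIn_face (𝒜 := 𝒜)
    (F := {km : ℕ × ℕ | (km.2 : ℚ) = km.1 * n}) (N := {km : ℕ × ℕ | (km.2 : ℚ) < km.1 * n})
    (by simp) (Set.disjoint_left.2 fun km h h' => h'.ne h) ?_ ?_ ?_ ?_ ?_
  case refine_5 =>
    rw [hle]
    exact hfg
  all_goals
    intro i hi j hj
    simp only [Set.mem_ofPred_eq, Prod.fst_add, Prod.snd_add, Nat.cast_add] at *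
    linarith
end

section
/- Let R be a commutative ring graded by ℕ × ℕ with homogeneous pieces J_{k,m}, and assume J_{0,m} = 0 for every m ≥ 1. If R is finitely generated as an algebra over the subring J_{0,0}, then there exists a natural number c such that J_{k,m} = 0 whenever m > c·k. -/
/-- The elements of a graded ring whose nonzero components all have degrees in a fixed
additive submonoid of the grading monoid form a subring. -/
def GradedRing.supportedSubring {ι R : Type*} [DecidableEq ι] [AddCommMonoid ι] [CommRing R]
    (𝒜 : ι → AddSubgroup R) [GradedRing 𝒜] (P : AddSubmonoid ι) : Subring R where
  carrier := {x | ∀ i, (DirectSum.decompose 𝒜 x i : R) ≠ 0 → i ∈ P}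
  zero_mem' i hi := by simp at hi
  one_mem' i hi := by
    by_contra hiP
    refine hi (DirectSum.decompose_of_mem_ne 𝒜 SetLike.GradedOne.one_mem ?_)
    rintro rfl
    exact hiP P.zero_mem
  add_mem' {x y} hx hy i hi := by
    by_contra hiP
    exact hi (by simp [not_imp_comm.1 (hx i) hiP, not_imp_comm.1 (hy i) hiP])
  neg_mem' {x} hx i hi := hx i fun h ↦ hi <| by
    rw [DirectSum.decompose_neg]
    exact neg_eq_zero.2 h
  mul_mem' {x y} hx hy i hi := by
    classical
    rw [DirectSum.decompose_mul, DirectSum.coe_mul_apply] at hi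
    obtain ⟨⟨j, k⟩, hjk, hne⟩ := Finset.exists_ne_zero_of_sum_ne_zero hi
    obtain rfl := (Finset.mem_filter.1 hjk).2
    exact P.add_mem (hx j (left_ne_zero_of_mul hne)) (hy k (right_ne_zero_of_mul hne))

/-- The pairs `(k, m)` of natural numbers with `m ≤ c * k`. -/
def AddSubmonoid.slopeLE (c : ℕ) : AddSubmonoid (ℕ × ℕ) where
  carrier := {n | n.2 ≤ c * n.1}
  zero_mem' := by simp
  add_mem' {a b} ha hb := by
    simpa [mul_add] using add_le_add ha hb

/-- Let `R` be a commutative ring graded by `ℕ × ℕ` with pieces `𝒜 (k, m)` such that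
`𝒜 (0, m) = 0` for all `m ≥ 1`.  If `R` is finitely generated as an algebra over the
subring `𝒜 (0, 0)`, then there is a natural number `c` such that `𝒜 (k, m) = 0` whenever
`m > c * k`. -/
theorem bounded_slope_of_finitely_generated {R : Type*} [CommRing R]
    (𝒜 : ℕ × ℕ → AddSubgroup R) [GradedRing 𝒜]
    (hzero : ∀ m : ℕ, 1 ≤ m → 𝒜 (0, m) = ⊥)
    (hfg : ∃ s : Finset R,
      Subring.closure ((𝒜 (0, 0) : Set R) ∪ ↑s) = ⊤) :
    ∃ c : ℕ, ∀ k m : ℕ, m > c * k → 𝒜 (k, m) = ⊥ := by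
  classical
  obtain ⟨s, hs⟩ := hfg
  let c := s.sup fun x ↦ (DirectSum.decompose 𝒜 x).support.sup Prod.snd
  have htop : GradedRing.supportedSubring 𝒜 (AddSubmonoid.slopeLE c) = ⊤ := by
    rw [← top_le_iff, ← hs, Subring.closure_le]
    rintro x (hx | hx) n hn
    · by_cases h : (0, 0) = n
      · exact h ▸ zero_mem _
      · exact absurd (DirectSum.decompose_of_mem_ne 𝒜 hx h) hn
    · obtain ⟨k, m⟩ := n
      change m ≤ c * k
      rcases Nat.eq_zero_or_pos k with rfl | hk
      · by_contra! hm
        exact hn ((AddSubgroup.eq_bot_iff_forall _).1 (hzero m (by lia)) _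
          (DirectSum.decompose 𝒜 x (0, m)).2)
      · have hsupp : (k, m) ∈ (DirectSum.decompose 𝒜 x).support := by
          simpa using hn
        have hm : m ≤ c := (Finset.le_sup (f := Prod.snd) hsupp).trans
          (Finset.le_sup (f := fun x ↦ (DirectSum.decompose 𝒜 x).support.sup Prod.snd) hx)
        exact hm.trans (Nat.le_mul_of_pos_right c hk)
  refine ⟨c, fun k m hkm ↦ (AddSubgroup.eq_bot_iff_forall _).2 fun x hx ↦ ?_⟩
  by_contra hx0
  have hmem : x ∈ GradedRing.supportedSubring 𝒜 (AddSubmonoid.slopeLE c) :=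
    htop ▸ Subring.mem_top x
  exact hkm.not_ge (hmem (k, m) (by rwa [DirectSum.decompose_of_mem_same 𝒜 hx]))
end
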